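/- Let ẽ be an edge of a 2-dimensional reference triangle F̃ and 1 < q < 2. If κ̃ is a polynomial of degree ≤ r−3 on ẽ and κ̃₁ denotes its extension by zero to ∂F̃, then κ̃₁ ∈ W^{1−1/q,q}(∂F̃) with ‖κ̃₁‖_{W^{1−1/q,q}(∂F̃)} ≤ C‖κ̃‖_{W^{1−1/q,q}(ẽ)}, where C depends only on q, r, and F̃. In particular, extension by zero of polynomials across edge endpoints is bounded in the fractional Sobolev space of order 1−1/q when q < 2. -/

import Mathlib

noncomputable section
open MeasureTheory Real Classical
open scoped ENNReal NNReal

abbrev E2 : Type := EuclideanSpace ℝ (Fin 2)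

/-- f is (the restriction to K of) a polynomial of total degree ≤ n. -/
def IsPolyOn₂ (n : ℕ) (K : Set E2) (f : E2 → ℝ) : Prop :=
  ∃ P : MvPolynomial (Fin 2) ℝ, P.totalDegree ≤ n ∧
    ∀ x ∈ K, f x = MvPolynomial.eval (fun i => x i) P

/-- Extended-real-valued W^{s,q} norm of f on a curve c (1-dimensional Hausdorff
measure, Gagliardo seminorm); finiteness encodes membership in W^{s,q}(c). -/
def eWsq (s q : ℝ) (c : Set E2) (f : E2 → ℝ) : ℝ≥0∞ :=
  (∫⁻ x in c, ((‖f x‖₊ : ℝ≥0∞) ^ q) ∂μH[1]) ^ (1/q) +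
  (∫⁻ x in c, ∫⁻ y in c,
      ((‖f x - f y‖₊ : ℝ≥0∞) ^ q) / (edist x y) ^ (1 + s * q) ∂μH[1] ∂μH[1]) ^ (1/q)

/-- On the space of polynomials with `n + 1` real coefficients, the sup norm over `[0, 1]` is
controlled by the `L^q` norm over `[0, 1]`. -/
lemma exists_rpow_abs_sum_le_integral (n : ℕ) {q : ℝ} (hq : 0 < q) :
    ∃ K : ℝ, 0 ≤ K ∧ ∀ c : Fin (n + 1) → ℝ, ∀ t ∈ Set.Icc (0 : ℝ) 1,
      |∑ i, c i * t ^ (i : ℕ)| ^ q ≤ K * ∫ s in (0 : ℝ)..1, |∑ i, c i * s ^ (i : ℕ)| ^ q := by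
  have hcont : Continuous fun z : (Fin (n + 1) → ℝ) × ℝ ↦ |∑ i, z.1 i * z.2 ^ (i : ℕ)| ^ q :=
    Continuous.rpow_const (by fun_prop) fun _ ↦ Or.inr hq.le
  set N : (Fin (n + 1) → ℝ) → ℝ := fun c ↦ ∫ s in (0 : ℝ)..1, |∑ i, c i * s ^ (i : ℕ)| ^ q
    with hN
  have hNc : Continuous N :=
    intervalIntegral.continuous_parametric_intervalIntegral_of_continuous' hcont 0 1
  have hNpos : ∀ c, c ≠ 0 → 0 < N c := by
    intro c hc
    have hex : ∃ t ∈ Set.Ioo (0 : ℝ) 1, ∑ i, c i * t ^ (i : ℕ) ≠ 0 := by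
      by_contra! h
      apply hc
      have hQ : (∑ i, Polynomial.C (c i) * Polynomial.X ^ (i : ℕ)) = (0 : Polynomial ℝ) := by
        apply Polynomial.eq_zero_of_infinite_isRoot
        refine (Set.Ioo_infinite (zero_lt_one (α := ℝ))).mono fun t ht ↦ ?_
        simp [Polynomial.IsRoot, Polynomial.eval_finsetSum, h t ht]
      funext j
      have := congrArg (fun P ↦ Polynomial.coeff P (j : ℕ)) hQ
      simpa [Polynomial.finsetSum_coeff, Polynomial.coeff_C_mul, Polynomial.coeff_X_pow,
        Fin.val_inj] using this
    obtain ⟨t, ht, h0⟩ := hex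
    refine intervalIntegral.integral_pos zero_lt_one
      (hcont.comp (Continuous.prodMk_right c)).continuousOn (fun _ _ ↦ by positivity)
      ⟨t, Set.Ioo_subset_Icc_self ht, ?_⟩
    exact Real.rpow_pos_of_pos (abs_pos.2 h0) q
  obtain ⟨c₀, hc₀, hmin⟩ := (isCompact_sphere (0 : Fin (n + 1) → ℝ) 1).exists_isMinOn
    (NormedSpace.sphere_nonempty.2 zero_le_one) hNc.continuousOn
  have hm : 0 < N c₀ := hNpos c₀ fun h ↦ by simp [h] at hc₀
  refine ⟨((n : ℝ) + 1) ^ q / N c₀, by positivity, fun c t ht ↦ ?_⟩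
  have hsup : |∑ i, c i * t ^ (i : ℕ)| ≤ ((n : ℝ) + 1) * ‖c‖ := by
    refine (Finset.abs_sum_le_sum_abs _ _).trans ?_
    refine (Finset.sum_le_card_nsmul _ _ ‖c‖ fun i _ ↦ ?_).trans (by simp)
    rw [abs_mul, abs_of_nonneg (pow_nonneg ht.1 _)]
    exact (mul_le_of_le_one_right (abs_nonneg _) (pow_le_one₀ ht.1 ht.2)).trans
      (norm_le_pi_norm c i)
  have hhom : N c₀ * ‖c‖ ^ q ≤ N c := by
    rcases eq_or_ne c 0 with rfl | hc
    · simp [hN, Real.zero_rpow hq.ne']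
    · have hc' : 0 < ‖c‖ := norm_pos_iff.2 hc
      have h1 : N c₀ ≤ N (‖c‖⁻¹ • c) := hmin (by simp [norm_smul, hc'.ne'])
      have h2 : N c = ‖c‖ ^ q * N (‖c‖⁻¹ • c) := by
        simp only [hN]
        rw [← intervalIntegral.integral_const_mul]
        congr 1
        funext s
        rw [← Real.mul_rpow hc'.le (abs_nonneg _)]
        congr 1
        rw [← abs_of_pos hc', ← abs_mul, abs_of_pos hc', Finset.mul_sum]
        congr 1
        refine Finset.sum_congr rfl fun i _ ↦ ?_
        simp only [Pi.smul_apply, smul_eq_mul]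
        field_simp
      rw [h2, mul_comm]
      gcongr
  calc |∑ i, c i * t ^ (i : ℕ)| ^ q ≤ (((n : ℝ) + 1) * ‖c‖) ^ q := by gcongr
    _ = ((n : ℝ) + 1) ^ q / N c₀ * (N c₀ * ‖c‖ ^ q) := by
      rw [Real.mul_rpow (by positivity) (by positivity)]
      field_simp
    _ ≤ _ := by gcongr

lemma lintegral_segment {a b : E2} (hab : a ≠ b) (g : E2 → ℝ≥0∞) :
    ∫⁻ x in segment ℝ a b, g x ∂μH[1] =
      edist a b * ∫⁻ t in Set.Icc (0 : ℝ) 1, g (AffineMap.lineMap a b t) := by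
  have hemb : MeasurableEmbedding (AffineMap.lineMap a b : ℝ → E2) :=
    Continuous.measurableEmbedding AffineMap.lineMap_continuous
      (AffineMap.lineMap_injective ℝ hab)
  have hμ : (μH[1] : Measure E2).restrict (segment ℝ a b) =
      nndist a b • (volume.restrict (Set.Icc (0 : ℝ) 1)).map (AffineMap.lineMap a b) := by
    ext s hs
    rw [Measure.restrict_apply hs, Measure.smul_apply, hemb.map_apply,
      Measure.restrict_apply (hemb.measurable hs), segment_eq_image_lineMap,
      ← Set.image_preimage_inter, hausdorffMeasure_lineMap_image, hausdorffMeasure_real]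
  rw [hμ, lintegral_smul_measure, hemb.lintegral_map, edist_nndist]
  rfl

lemma IsPolyOn₂.exists_coeff {n : ℕ} {a b : E2} {κ : E2 → ℝ}
    (h : IsPolyOn₂ n (segment ℝ a b) κ) :
    ∃ c : Fin (n + 1) → ℝ, ∀ t ∈ Set.Icc (0 : ℝ) 1,
      κ (AffineMap.lineMap a b t) = ∑ i, c i * t ^ (i : ℕ) := by
  obtain ⟨P, hP, hκ⟩ := h
  set Q : Polynomial ℝ := MvPolynomial.aeval
    (fun i : Fin 2 ↦ Polynomial.C (b i - a i) * Polynomial.X + Polynomial.C (a i)) P with hQ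
  have hdeg : Q.natDegree < n + 1 := by
    have := MvPolynomial.aeval_natDegree_le P hP
      (fun i : Fin 2 ↦ Polynomial.C (b i - a i) * Polynomial.X + Polynomial.C (a i))
      (n := 1) (fun i ↦ Polynomial.natDegree_linear_le)
    exact this.trans_lt (by lia)
  refine ⟨fun i ↦ Q.coeff i, fun t ht ↦ ?_⟩
  rw [hκ _ (by rw [segment_eq_image_lineMap]; exact Set.mem_image_of_mem _ ht),
    ← Finset.sum_range (fun i ↦ Q.coeff i * t ^ i), ← Polynomial.eval_eq_sum_range' hdeg]
  rw [hQ, MvPolynomial.aeval_def, ← Polynomial.coe_evalRingHom, MvPolynomial.hom_eval₂]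
  rw [MvPolynomial.eval, MvPolynomial.coe_eval₂Hom]
  congr 1
  · ext; simp
  · funext i
    simp [AffineMap.lineMap_apply]
    ring

/-- Inverse inequality: on polynomials of bounded degree on a segment, the sup norm is controlled
by the `L^q` norm. -/
lemma exists_enorm_rpow_le_lintegral (n : ℕ) {q : ℝ} (hq : 0 < q) {a b : E2} (hab : a ≠ b) :
    ∃ K : ℝ≥0∞, K ≠ ∞ ∧ ∀ κ : E2 → ℝ, IsPolyOn₂ n (segment ℝ a b) κ →
      ∀ x ∈ segment ℝ a b,
        ((‖κ x‖₊ : ℝ≥0∞) ^ q) ≤ K * ∫⁻ y in segment ℝ a b, ((‖κ y‖₊ : ℝ≥0∞) ^ q) ∂μH[1] := by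
  obtain ⟨K, hK0, hK⟩ := exists_rpow_abs_sum_le_integral n hq
  have he0 : edist a b ≠ 0 := edist_pos.2 hab |>.ne'
  have hcoe : ∀ z : ℝ, ((‖z‖₊ : ℝ≥0∞) ^ q) = ENNReal.ofReal (|z| ^ q) := fun z ↦ by
    rw [← ENNReal.ofReal_rpow_of_nonneg (abs_nonneg _) hq.le, ← Real.norm_eq_abs,
      ofReal_norm]
    rfl
  refine ⟨ENNReal.ofReal K / edist a b, ENNReal.div_ne_top ENNReal.ofReal_ne_top he0,
    fun κ hκ x hx ↦ ?_⟩
  obtain ⟨c, hc⟩ := hκ.exists_coeff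
  rw [segment_eq_image_lineMap] at hx
  obtain ⟨t, ht, rfl⟩ := hx
  rw [lintegral_segment hab, ← mul_assoc, ENNReal.div_mul_cancel he0 (edist_ne_top _ _), hcoe,
    hc t ht]
  have hcont : Continuous fun s : ℝ ↦ |∑ i, c i * s ^ (i : ℕ)| ^ q :=
    Continuous.rpow_const (by fun_prop) fun _ ↦ Or.inr hq.le
  have hint : ∫⁻ s in Set.Icc (0 : ℝ) 1, ((‖κ (AffineMap.lineMap a b s)‖₊ : ℝ≥0∞) ^ q) =
      ENNReal.ofReal (∫ s in (0 : ℝ)..1, |∑ i, c i * s ^ (i : ℕ)| ^ q) := by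
    rw [intervalIntegral.integral_of_le zero_le_one, ← integral_Icc_eq_integral_Ioc,
      ofReal_integral_eq_lintegral_ofReal hcont.continuousOn.integrableOn_Icc
        (ae_of_all _ fun s ↦ by positivity)]
    refine setLIntegral_congr_fun measurableSet_Icc fun s hs ↦ ?_
    simp only [hcoe, hc s hs]
  rw [hint, ← ENNReal.ofReal_mul hK0]
  exact ENNReal.ofReal_le_ofReal (hK c t ht)

lemma sum_eq_of_pairwise_ne {M : Type*} [AddCommMonoid M] {i j k : Fin 3} (hij : i ≠ j)
    (hik : i ≠ k) (hjk : j ≠ k) (f : Fin 3 → M) : ∑ l, f l = f i + f j + f k := by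
  have h : (Finset.univ : Finset (Fin 3)) = {i, j, k} := by
    ext l
    simp only [Finset.mem_univ, Finset.mem_insert, Finset.mem_singleton, true_iff]
    lia
  rw [h, Finset.sum_insert (by simp [hij, hik]), Finset.sum_pair hjk, add_assoc]

lemma AffineBasis.mem_segment_of_coord_eq_zero (b : AffineBasis (Fin 3) ℝ E2) {i j k : Fin 3}
    (hij : i ≠ j) (hik : i ≠ k) (hjk : j ≠ k) {x : E2} (hx : ∀ l, 0 ≤ b.coord l x)
    (hk : b.coord k x = 0) : x ∈ segment ℝ (b i) (b j) := by
  have h1 := b.sum_coord_apply_eq_one x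
  have h2 := b.linear_combination_coord_eq_self x
  rw [sum_eq_of_pairwise_ne hij hik hjk, hk] at h1 h2
  exact ⟨_, _, hx i, hx j, by simpa using h1, by simpa using h2⟩

lemma AffineBasis.frontier_convexHull_subset (b : AffineBasis (Fin 3) ℝ E2) {i j k : Fin 3}
    (hij : i ≠ j) (hik : i ≠ k) (hjk : j ≠ k) :
    frontier (convexHull ℝ (Set.range b)) ⊆
      segment ℝ (b i) (b j) ∪ (segment ℝ (b i) (b k) ∪ segment ℝ (b j) (b k)) := by
  intro x hx
  have hcl : IsClosed (convexHull ℝ (Set.range b)) :=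
    ((Set.finite_range b).isCompact_convexHull (𝕜 := ℝ)).isClosed
  rw [hcl.frontier_eq, b.interior_convexHull, b.convexHull_eq_nonneg_coord] at hx
  obtain ⟨h0, hx⟩ := hx
  simp only [Set.mem_ofPred_eq, not_forall, not_lt] at h0 hx
  obtain ⟨m, hm⟩ := hx
  have hm0 := le_antisymm hm (h0 m)
  have hcase : m = i ∨ m = j ∨ m = k := by lia
  rcases hcase with rfl | rfl | rfl
  · exact Or.inr (Or.inr (b.mem_segment_of_coord_eq_zero hjk hij.symm hik.symm h0 hm0))
  · exact Or.inr (Or.inl (b.mem_segment_of_coord_eq_zero hik hij hjk.symm h0 hm0))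
  · exact Or.inl (b.mem_segment_of_coord_eq_zero hij hik hjk h0 hm0)

/-- Two edges of a triangle with a common vertex meet at a positive angle. -/
lemma AffineBasis.exists_le_mul_dist_lineMap (b : AffineBasis (Fin 3) ℝ E2) {i j k : Fin 3}
    (hij : i ≠ j) (hjk : j ≠ k) :
    ∃ L : ℝ, ∀ t s : ℝ,
      t ≤ L * dist (AffineMap.lineMap (b i) (b j) t) (AffineMap.lineMap (b i) (b k) s) := by
  refine ⟨‖(b.coord j).linear.toContinuousLinearMap‖, fun t s ↦ ?_⟩
  set x := AffineMap.lineMap (b i) (b j) t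
  set y := AffineMap.lineMap (b i) (b k) s
  have hx : b.coord j x = t := by
    rw [AffineMap.apply_lineMap, b.coord_apply_ne hij.symm, b.coord_apply_eq]
    simp [AffineMap.lineMap_apply]
  have hy : b.coord j y = 0 := by
    rw [AffineMap.apply_lineMap, b.coord_apply_ne hij.symm, b.coord_apply_ne hjk]
    simp
  have h := (b.coord j).linear.toContinuousLinearMap.le_opNorm (x - y)
  rw [LinearMap.coe_toContinuousLinearMap', ← vsub_eq_sub x y, AffineMap.linearMap_vsub, hx, hy,
    vsub_eq_sub, sub_zero, vsub_eq_sub, ← dist_eq_norm] at h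
  exact (le_abs_self t).trans h

lemma lintegral_rpow_inv_Icc_lt_top {α : ℝ} (hα : α < 1) :
    ∫⁻ t in Set.Icc (0 : ℝ) 1, (ENNReal.ofReal t ^ α)⁻¹ < ∞ := by
  have h := (intervalIntegral.intervalIntegrable_rpow' (a := 0) (b := 1)
    (r := -α) (by linarith)).1
  rw [setLIntegral_congr Ioc_ae_eq_Icc.symm]
  refine lt_of_eq_of_lt (setLIntegral_congr_fun measurableSet_Ioc fun t ht ↦ ?_)
    h.lintegral_lt_top
  rw [← ENNReal.rpow_neg, ENNReal.ofReal_rpow_of_pos ht.1]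

/-- The kernel `|x - y|^{-q}` is integrable over the product of two adjacent edges of a triangle
when `q < 2`. -/
lemma AffineBasis.lintegral_edist_rpow_inv_lt_top (b : AffineBasis (Fin 3) ℝ E2)
    {i j k : Fin 3} (hij : i ≠ j) (hik : i ≠ k) (hjk : j ≠ k) {q : ℝ} (hq0 : 0 < q)
    (hq2 : q < 2) :
    ∫⁻ x in segment ℝ (b i) (b j), ∫⁻ y in segment ℝ (b i) (b k),
      (edist x y ^ q)⁻¹ ∂μH[1] ∂μH[1] < ∞ := by
  obtain ⟨L₁, hL₁⟩ := b.exists_le_mul_dist_lineMap hij hjk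
  obtain ⟨L₂, hL₂⟩ := b.exists_le_mul_dist_lineMap hik hjk.symm
  set L : ℝ := max (max L₁ L₂) 1
  have hL : 0 < L := zero_lt_one.trans_le (le_max_right _ _)
  set g : ℝ → ℝ≥0∞ := fun t ↦ (ENNReal.ofReal t ^ (q / 2))⁻¹ with hg
  have hgm : Measurable g := by fun_prop
  set A := ∫⁻ t in Set.Icc (0 : ℝ) 1, g t
  have hA : A < ∞ := lintegral_rpow_inv_Icc_lt_top (by linarith)
  have hbound : ∀ t s : ℝ,
      (edist (AffineMap.lineMap (b i) (b j) t : E2) (AffineMap.lineMap (b i) (b k) s) ^ q)⁻¹ ≤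
        ENNReal.ofReal L ^ q * (g t * g s) := by
    intro t s
    set d := edist (AffineMap.lineMap (b i) (b j) t : E2) (AffineMap.lineMap (b i) (b k) s)
      with hd
    have hd' : ENNReal.ofReal L * d = ENNReal.ofReal (L *
        dist (AffineMap.lineMap (b i) (b j) t : E2) (AffineMap.lineMap (b i) (b k) s)) := by
      rw [ENNReal.ofReal_mul hL.le, hd, edist_dist]
    have ht : ENNReal.ofReal t ≤ ENNReal.ofReal L * d := by
      rw [hd']
      refine ENNReal.ofReal_le_ofReal ((hL₁ t s).trans ?_)
      gcongr
      exact (le_max_left _ _).trans (le_max_left _ _)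
    have hs : ENNReal.ofReal s ≤ ENNReal.ofReal L * d := by
      rw [hd']
      refine ENNReal.ofReal_le_ofReal ((hL₂ s t).trans ?_)
      rw [dist_comm]
      gcongr
      exact (le_max_right _ _).trans (le_max_left _ _)
    have hprod : ENNReal.ofReal t ^ (q / 2) * ENNReal.ofReal s ^ (q / 2) ≤
        ENNReal.ofReal L ^ q * d ^ q := by
      calc _ ≤ (ENNReal.ofReal L * d) ^ (q / 2) * (ENNReal.ofReal L * d) ^ (q / 2) := by gcongr
        _ = (ENNReal.ofReal L * d) ^ q := by
          rw [← ENNReal.rpow_add_of_nonneg _ _ (by positivity) (by positivity), add_halves]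
        _ = _ := ENNReal.mul_rpow_of_nonneg _ _ hq0.le
    have hLq0 : ENNReal.ofReal L ^ q ≠ 0 := by simp [hL]
    have hLqt : ENNReal.ofReal L ^ q ≠ ∞ := by simp [hq0.le]
    rw [hg]
    dsimp only
    rw [← ENNReal.mul_inv (Or.inr (by finiteness)) (Or.inl (by finiteness))]
    have h := ENNReal.inv_le_inv.2 hprod
    rw [ENNReal.mul_inv (Or.inl hLq0) (Or.inl hLqt)] at h
    calc (d ^ q)⁻¹ = ENNReal.ofReal L ^ q * ((ENNReal.ofReal L ^ q)⁻¹ * (d ^ q)⁻¹) := by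
          rw [← mul_assoc, ENNReal.mul_inv_cancel hLq0 hLqt, one_mul]
      _ ≤ _ := by gcongr
  rw [lintegral_segment (b.ind.injective.ne hij)]
  simp_rw [lintegral_segment (b.ind.injective.ne hik)]
  refine ENNReal.mul_lt_top (edist_lt_top _ _) ?_
  calc _ ≤ ∫⁻ t in Set.Icc (0 : ℝ) 1,
        edist (b i) (b k) * (ENNReal.ofReal L ^ q * A) * g t := by
        refine lintegral_mono fun t ↦ ?_
        rw [mul_assoc]
        gcongr
        refine (lintegral_mono fun s ↦ hbound t s).trans_eq ?_
        rw [lintegral_const_mul _ (by fun_prop), lintegral_const_mul _ hgm]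
        ring
    _ = edist (b i) (b k) * (ENNReal.ofReal L ^ q * A) * A := lintegral_const_mul _ hgm
    _ < ∞ := by finiteness

lemma isFiniteMeasure_restrict_segment (a b : E2) :
    IsFiniteMeasure ((μH[1] : Measure E2).restrict (segment ℝ a b)) :=
  ⟨by rw [Measure.restrict_apply_univ, hausdorffMeasure_segment]; exact edist_lt_top _ _⟩

lemma measurableSet_segment (a b : E2) : MeasurableSet (segment ℝ a b) := by
  rw [segment_eq_image_lineMap]
  exact (isCompact_Icc.image AffineMap.lineMap_continuous).measurableSet

/-- The Gagliardo energy of an extension by zero is controlled by the energy of the function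
and its supremum times the interaction of the domain with its surroundings. -/
lemma lintegral_extend_zero_le {S T Γ : Set E2} (hS : MeasurableSet S) (hT : MeasurableSet T)
    (hΓ : Γ ⊆ S ∪ T) [SFinite ((μH[1] : Measure E2).restrict S)]
    [SFinite ((μH[1] : Measure E2).restrict T)] {q : ℝ} (hq : 0 < q)
    (κ : E2 → ℝ) {M : ℝ≥0∞} (hM : ∀ x ∈ S, (‖κ x‖₊ : ℝ≥0∞) ^ q ≤ M) :
    ∫⁻ x in Γ, ∫⁻ y in Γ, ((‖(if x ∈ S then κ x else 0) - (if y ∈ S then κ y else 0)‖₊ : ℝ≥0∞) ^ q)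
        / edist x y ^ q ∂μH[1] ∂μH[1] ≤
      (∫⁻ x in S, ∫⁻ y in S, ((‖κ x - κ y‖₊ : ℝ≥0∞) ^ q) / edist x y ^ q ∂μH[1] ∂μH[1]) +
      M * ((∫⁻ x in S, ∫⁻ y in T, (edist x y ^ q)⁻¹ ∂μH[1] ∂μH[1]) +
        ∫⁻ x in T, ∫⁻ y in S, (edist x y ^ q)⁻¹ ∂μH[1] ∂μH[1]) := by
  have hΓ' : Γ ⊆ S ∪ T \ S := by rwa [Set.union_sdiff_self]
  have hsplit : ∀ g : E2 → ℝ≥0∞,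
      ∫⁻ x in Γ, g x ∂μH[1] ≤ ∫⁻ x in S, g x ∂μH[1] + ∫⁻ x in T \ S, g x ∂μH[1] := fun g ↦
    (lintegral_mono_set hΓ').trans (lintegral_union_le _ _ _)
  have hker : ∀ (U : Set E2) [SFinite ((μH[1] : Measure E2).restrict U)],
      Measurable fun x : E2 ↦ ∫⁻ y in U, (edist x y ^ q)⁻¹ ∂μH[1] := by
    intro U _
    apply Measurable.lintegral_prod_right
    simp only [Function.uncurry_def]
    fun_prop
  have hkx : ∀ x : E2, Measurable fun y : E2 ↦ (edist x y ^ q)⁻¹ := fun x ↦ by fun_prop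
  have hin : ∀ x ∈ S, ∫⁻ y in Γ, ((‖(if x ∈ S then κ x else 0) -
      (if y ∈ S then κ y else 0)‖₊ : ℝ≥0∞) ^ q) / edist x y ^ q ∂μH[1] ≤
      (∫⁻ y in S, ((‖κ x - κ y‖₊ : ℝ≥0∞) ^ q) / edist x y ^ q ∂μH[1]) +
        M * ∫⁻ y in T, (edist x y ^ q)⁻¹ ∂μH[1] := by
    intro x hx
    refine (hsplit _).trans (add_le_add (setLIntegral_mono' hS fun y hy ↦ ?_) ?_)
    · simp [hx, hy]
    · rw [← lintegral_const_mul _ (hkx x)]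
      refine (setLIntegral_mono' (hT.diff hS) fun y hy ↦ ?_).trans
        (lintegral_mono_set Set.sdiff_subset)
      simp only [hx, hy.2, if_true, if_false, sub_zero, div_eq_mul_inv]
      gcongr
      exact hM x hx
  have hout : ∀ x ∈ T \ S, ∫⁻ y in Γ, ((‖(if x ∈ S then κ x else 0) -
      (if y ∈ S then κ y else 0)‖₊ : ℝ≥0∞) ^ q) / edist x y ^ q ∂μH[1] ≤
      M * ∫⁻ y in S, (edist x y ^ q)⁻¹ ∂μH[1] := by
    intro x hx
    rw [← lintegral_const_mul _ (hkx x), ← add_zero (∫⁻ y in S, _ ∂μH[1])]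
    refine (hsplit _).trans (add_le_add (setLIntegral_mono' hS fun y hy ↦ ?_) ?_)
    · simp only [hx.2, hy, if_true, if_false, zero_sub, nnnorm_neg, div_eq_mul_inv]
      gcongr
      exact hM y hy
    · refine (setLIntegral_mono' (g := fun _ ↦ 0) (hT.diff hS) fun y hy ↦ ?_).trans (by simp)
      simp [hx.2, hy.2, hq]
  refine (hsplit _).trans ?_
  rw [mul_add, ← add_assoc, ← lintegral_const_mul _ (hker T), ← lintegral_const_mul _ (hker S),
    ← lintegral_add_right _ ((hker T).const_mul M)]
  refine add_le_add (setLIntegral_mono' hS hin) ?_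
  exact (setLIntegral_mono' (hT.diff hS) hout).trans (lintegral_mono_set Set.sdiff_subset)

lemma AffineBasis.exists_eWsq_extend_zero_le (b : AffineBasis (Fin 3) ℝ E2) (n : ℕ)
    {i j : Fin 3} (hij : i ≠ j) {q : ℝ} (hq1 : 1 < q) (hq2 : q < 2) :
    ∃ C : ℝ≥0, ∀ κ : E2 → ℝ, IsPolyOn₂ n (segment ℝ (b i) (b j)) κ →
      eWsq (1 - 1/q) q (frontier (convexHull ℝ (Set.range b)))
          (fun x => if x ∈ segment ℝ (b i) (b j) then κ x else 0) ≤
        C * eWsq (1 - 1/q) q (segment ℝ (b i) (b j)) κ := by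
  have hq0 : 0 < q := by linarith
  have hq' : 0 ≤ 1 / q := by positivity
  have hexp : 1 + (1 - 1 / q) * q = q := by field_simp; ring
  obtain ⟨k, hik, hjk⟩ : ∃ k : Fin 3, i ≠ k ∧ j ≠ k := by
    revert i j
    decide
  set S := segment ℝ (b i) (b j)
  set T₁ := segment ℝ (b i) (b k)
  set T₂ := segment ℝ (b j) (b k)
  have hS : MeasurableSet S := measurableSet_segment _ _
  have hT₁ : MeasurableSet T₁ := measurableSet_segment _ _
  have hT₂ : MeasurableSet T₂ := measurableSet_segment _ _
  have : IsFiniteMeasure ((μH[1] : Measure E2).restrict S) := isFiniteMeasure_restrict_segment _ _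
  have : IsFiniteMeasure ((μH[1] : Measure E2).restrict T₁) :=
    isFiniteMeasure_restrict_segment _ _
  have : IsFiniteMeasure ((μH[1] : Measure E2).restrict T₂) :=
    isFiniteMeasure_restrict_segment _ _
  have : IsFiniteMeasure ((μH[1] : Measure E2).restrict (T₁ ∪ T₂)) := by
    refine ⟨(Measure.restrict_union_le T₁ T₂ Set.univ).trans_lt ?_⟩
    exact measure_lt_top _ _
  have hS' : S = segment ℝ (b j) (b i) := segment_symm _ _ _
  set I : Set E2 → Set E2 → ℝ≥0∞ := fun U V ↦
    ∫⁻ x in U, ∫⁻ y in V, (edist x y ^ q)⁻¹ ∂μH[1] ∂μH[1] with hI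
  have hker : Measurable fun x : E2 ↦ ∫⁻ y in T₁, (edist x y ^ q)⁻¹ ∂μH[1] := by
    apply Measurable.lintegral_prod_right
    simp only [Function.uncurry_def]
    fun_prop
  have hST : I S (T₁ ∪ T₂) < ∞ := by
    calc I S (T₁ ∪ T₂) ≤ I S T₁ + I S T₂ := by
          simp only [hI]
          rw [← lintegral_add_left hker]
          exact lintegral_mono fun x ↦ lintegral_union_le _ _ _
      _ < ∞ := ENNReal.add_lt_top.2
          ⟨b.lintegral_edist_rpow_inv_lt_top hij hik hjk hq0 hq2, by
            rw [hS']; exact b.lintegral_edist_rpow_inv_lt_top hij.symm hjk hik hq0 hq2⟩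
  have hTS : I (T₁ ∪ T₂) S < ∞ := by
    calc I (T₁ ∪ T₂) S ≤ I T₁ S + I T₂ S := lintegral_union_le _ _ _
      _ < ∞ := ENNReal.add_lt_top.2
          ⟨b.lintegral_edist_rpow_inv_lt_top hik hij hjk.symm hq0 hq2, by
            rw [hS']; exact b.lintegral_edist_rpow_inv_lt_top hjk hij.symm hik.symm hq0 hq2⟩
  obtain ⟨K, hK, hinv⟩ :=
    exists_enorm_rpow_le_lintegral n hq0 (b.ind.injective.ne hij)
  set A := I S (T₁ ∪ T₂) + I (T₁ ∪ T₂) S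
  have hA : A < ∞ := ENNReal.add_lt_top.2 ⟨hST, hTS⟩
  have hC : 1 + (K * A) ^ (1 / q) ≠ ∞ := by finiteness
  refine ⟨(1 + (K * A) ^ (1 / q)).toNNReal, fun κ hκ ↦ ?_⟩
  rw [ENNReal.coe_toNNReal hC]
  have hΓ := b.frontier_convexHull_subset hij hik hjk
  have hE := lintegral_extend_zero_le hS (hT₁.union hT₂) hΓ hq0 κ (hinv κ hκ)
  have hL : ∫⁻ x in frontier (convexHull ℝ (Set.range b)),
      ((‖if x ∈ S then κ x else 0‖₊ : ℝ≥0∞) ^ q) ∂μH[1] ≤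
      ∫⁻ x in S, ((‖κ x‖₊ : ℝ≥0∞) ^ q) ∂μH[1] := by
    rw [← lintegral_indicator hS]
    refine (lintegral_mono fun x ↦ ?_).trans (setLIntegral_le_lintegral _ _)
    by_cases hx : x ∈ S <;> simp [hx, hq0]
  unfold eWsq
  rw [hexp]
  set N := ∫⁻ x in S, ((‖κ x‖₊ : ℝ≥0∞) ^ q) ∂μH[1]
  set G := ∫⁻ x in S, ∫⁻ y in S, ((‖κ x - κ y‖₊ : ℝ≥0∞) ^ q) / edist x y ^ q ∂μH[1] ∂μH[1]
  calc _ ≤ N ^ (1 / q) + (G + K * N * A) ^ (1 / q) := by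
        refine add_le_add (ENNReal.rpow_le_rpow hL hq') (ENNReal.rpow_le_rpow hE hq')
    _ ≤ N ^ (1 / q) + (G ^ (1 / q) + (K * A) ^ (1 / q) * N ^ (1 / q)) := by
        gcongr
        refine (ENNReal.rpow_add_le_add_rpow _ _ hq' ?_).trans_eq ?_
        · rw [div_le_one hq0]; exact hq1.le
        · rw [← ENNReal.mul_rpow_of_nonneg _ _ hq', mul_right_comm]
    _ = (1 + (K * A) ^ (1 / q)) * N ^ (1 / q) + 1 * G ^ (1 / q) := by ring
    _ ≤ (1 + (K * A) ^ (1 / q)) * N ^ (1 / q) + (1 + (K * A) ^ (1 / q)) * G ^ (1 / q) := by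
        gcongr
        exact le_self_add
    _ = _ := (mul_add _ _ _).symm

/-- extension by zero of a polynomial from one edge ẽ of a triangle F̃
to the whole boundary ∂F̃ is bounded in W^{1−1/q,q}(∂F̃) for 1 < q < 2:
κ̃₁ ∈ W^{1−1/q,q}(∂F̃) and ‖κ̃₁‖_{W^{1−1/q,q}(∂F̃)} ≤ C ‖κ̃‖_{W^{1−1/q,q}(ẽ)},
with C depending only on q, r, F̃. -/
theorem stmt7 (p : Fin 3 → E2) (hp : AffineIndependent ℝ p) (q : ℝ) (r : ℕ)
    (hq1 : 1 < q) (hq2 : q < 2) (hr : 3 ≤ r) :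
    ∃ C > 0, ∀ i j : Fin 3, i ≠ j →
      ∀ κ : E2 → ℝ, IsPolyOn₂ (r - 3) (segment ℝ (p i) (p j)) κ →
        eWsq (1 - 1/q) q (frontier (convexHull ℝ (Set.range p)))
            (fun x => if x ∈ segment ℝ (p i) (p j) then κ x else 0) ≤
          ENNReal.ofReal C * eWsq (1 - 1/q) q (segment ℝ (p i) (p j)) κ := by
  let b : AffineBasis (Fin 3) ℝ E2 :=
    ⟨p, hp, hp.affineSpan_eq_top_iff_card_eq_finrank_add_one.2 (by simp)⟩
  choose! C hC using fun (i j : Fin 3) (hij : i ≠ j) ↦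
    b.exists_eWsq_extend_zero_le (r - 3) hij hq1 hq2
  refine ⟨(1 + ∑ i, ∑ j, C i j : ℝ≥0), by positivity, fun i j hij κ hκ ↦
    (hC i j hij κ hκ).trans ?_⟩
  rw [ENNReal.ofReal_coe_nnreal]
  refine mul_le_mul_left (ENNReal.coe_le_coe.2 ?_) _
  calc C i j ≤ ∑ j, C i j := Finset.single_le_sum (fun _ _ ↦ zero_le) (Finset.mem_univ j)
    _ ≤ ∑ i, ∑ j, C i j :=
      Finset.single_le_sum (f := fun i ↦ ∑ j, C i j) (fun _ _ ↦ zero_le) (Finset.mem_univ i)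
    _ ≤ _ := le_add_self
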